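/- arXiv:2405.20002 — 2 statements merged into one kernel-verified Lean document; each statement's English description precedes it below -/
import Mathlib

section
/- Let k ≥ 7 and l > 2 be integers with l = qk + r where r = 2ε and ε = ±1 (so r = ±2). Then the minimum over all (k,l)-intersection matrices N of |K_N| · ∏_{i,j} N_{i,j}! equals (q−ε)! · q!^{k²−2k−2} · (q+ε)!^{2k+1}; that is, χ(k,l) = (q−ε)! q!^{k²−2k−2} (q+ε)!^{2k+1}. Moreover, every (k,l)-intersection matrix N attaining this minimum has trivial stabilizer K_N, and its multiset of entries consists of one entry equal to q−ε, k²−2k−2 entries equal to q, and 2k+1 entries equal to q+ε. -/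
/-- A `(k,l)`-intersection matrix: a `k × k` matrix of nonnegative integers all of whose
row sums and column sums equal `l`. -/
def IsInterMatrix (k l : ℕ) (N : Fin k → Fin k → ℕ) : Prop :=
  (∀ i, ∑ j, N i j = l) ∧ ∀ j, ∑ i, N i j = l

/-- `|K_N|`: the order of the stabilizer of `N` under the action of `S_k × S_k`
simultaneously permuting rows and columns. -/
noncomputable def stabCard {k : ℕ} (N : Fin k → Fin k → ℕ) : ℕ :=
  Nat.card {p : Equiv.Perm (Fin k) × Equiv.Perm (Fin k) // ∀ i j, N (p.1 i) (p.2 j) = N i j}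

/-- `|K_N| · ∏_{i,j} N_{i,j}!`, the order of the automorphism group of the `(k,l)`-bipartite
graph with bipartite adjacency matrix `N`. -/
noncomputable def autCard {k : ℕ} (N : Fin k → Fin k → ℕ) : ℕ :=
  stabCard N * ∏ i, ∏ j, (N i j).factorial

/-- The multiset of entries of a `k × k` matrix. -/
def entries {k : ℕ} (N : Fin k → Fin k → ℕ) : Multiset ℕ :=
  (Finset.univ : Finset (Fin k × Fin k)).val.map fun p => N p.1 p.2

open Finset

/-! ### The normalised factorial -/

/-- The factorial divided by the exponential function agreeing with it at `m` and `m + 1`. -/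
noncomputable def normFactorial (m x : ℕ) : ℝ :=
  (x.factorial : ℝ) / ((m : ℝ) + 1) ^ x * (((m : ℝ) + 1) ^ m / m.factorial)

lemma normFactorial_pos (m x : ℕ) : 0 < normFactorial m x := by
  unfold normFactorial
  positivity

lemma normFactorial_succ (m x : ℕ) :
    normFactorial m (x + 1) = normFactorial m x * (((x : ℝ) + 1) / ((m : ℝ) + 1)) := by
  unfold normFactorial
  rw [Nat.factorial_succ, pow_succ]
  push_cast
  field_simp

lemma normFactorial_self (m : ℕ) : normFactorial m m = 1 := by
  unfold normFactorial
  field_simp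

lemma normFactorial_self_succ (m : ℕ) : normFactorial m (m + 1) = 1 := by
  rw [normFactorial_succ, normFactorial_self]
  field_simp

lemma normFactorial_lt_of_lt_of_le {m x y : ℕ} (hxy : x < y) (hy : y ≤ m) :
    normFactorial m y < normFactorial m x := by
  have step : ∀ z, z < m → normFactorial m (z + 1) < normFactorial m z := by
    intro z hz
    rw [normFactorial_succ]
    have hz' : (z : ℝ) < m := by exact_mod_cast hz
    apply mul_lt_of_lt_one_right (normFactorial_pos m z)
    rw [div_lt_one (by positivity)]
    linarith
  induction y, hxy using Nat.le_induction with
  | base => exact step x (by omega)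
  | succ y _ ih => exact (step y (by omega)).trans (ih (by omega))

lemma normFactorial_lt_of_le_of_lt {m x y : ℕ} (hx : m + 1 ≤ x) (hxy : x < y) :
    normFactorial m x < normFactorial m y := by
  have step : ∀ z, m < z → normFactorial m z < normFactorial m (z + 1) := by
    intro z hz
    rw [normFactorial_succ]
    have hz' : (m : ℝ) < z := by exact_mod_cast hz
    apply lt_mul_of_one_lt_right (normFactorial_pos m z)
    rw [one_lt_div (by positivity)]
    linarith
  induction y, hxy using Nat.le_induction with
  | base => exact step x (by omega)
  | succ y hy ih => exact ih.trans (step y (by omega))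

lemma one_lt_normFactorial {m x : ℕ} (h₀ : x ≠ m) (h₁ : x ≠ m + 1) :
    1 < normFactorial m x := by
  rcases lt_or_ge x m with h | h
  · simpa [normFactorial_self] using normFactorial_lt_of_lt_of_le h le_rfl
  · simpa [normFactorial_self_succ] using
      normFactorial_lt_of_le_of_lt (m := m) (y := x) le_rfl (by omega)

lemma one_le_normFactorial (m x : ℕ) : 1 ≤ normFactorial m x := by
  by_cases h₀ : x = m
  · rw [h₀, normFactorial_self]
  by_cases h₁ : x = m + 1
  · rw [h₁, normFactorial_self_succ]
  exact (one_lt_normFactorial h₀ h₁).le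

lemma prod_map_normFactorial (m : ℕ) (s : Multiset ℕ) :
    (s.map (normFactorial m)).prod = ((s.map Nat.factorial).prod : ℕ) *
      ((((m : ℝ) + 1) ^ m / m.factorial) ^ s.card / ((m : ℝ) + 1) ^ s.sum) := by
  induction s using Multiset.induction_on with
  | empty => simp
  | cons x s ih =>
    simp only [Multiset.map_cons, Multiset.prod_cons, ih, Multiset.card_cons, Multiset.sum_cons,
      pow_succ, pow_add, normFactorial]
    push_cast
    field_simp

lemma one_le_prod_map_normFactorial (m : ℕ) (s : Multiset ℕ) :
    1 ≤ (s.map (normFactorial m)).prod := by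
  induction s using Multiset.induction_on with
  | empty => simp
  | cons x s ih =>
    rw [Multiset.map_cons, Multiset.prod_cons]
    exact one_le_mul_of_one_le_of_one_le (one_le_normFactorial m x) ih

lemma normFactorial_eq_one_of_prod_map_eq_one {m : ℕ} {s : Multiset ℕ}
    (h : (s.map (normFactorial m)).prod = 1) : ∀ x ∈ s, normFactorial m x = 1 := by
  intro x hx
  obtain ⟨t, rfl⟩ := Multiset.exists_cons_of_mem hx
  rw [Multiset.map_cons, Multiset.prod_cons] at h
  nlinarith [one_le_normFactorial m x, one_le_prod_map_normFactorial m t]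

/-- A point `m` such that `q` and `q + ε` are the two minimisers of `normFactorial m`. -/
lemma exists_normFactorial_minimisers {q a b : ℕ} {ε : ℤ} (hε : ε = 1 ∨ ε = -1)
    (ha : (a : ℤ) = q - ε) (hb : (b : ℤ) = q + ε) :
    ∃ m : ℕ, normFactorial m q = 1 ∧ normFactorial m b = 1 ∧
      (∀ x, normFactorial m x = 1 → x = q ∨ x = b) ∧ normFactorial m a ≤ 2 ∧
      ∀ x : ℕ, ε * ((x : ℤ) - q) < 0 →
        normFactorial m a ≤ normFactorial m x ∧ (normFactorial m x = normFactorial m a → x = a) := by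
  have key : ∀ m x, normFactorial m x = 1 → x = m ∨ x = m + 1 := by
    intro m x hx
    by_contra! h
    exact (one_lt_normFactorial h.1 h.2).ne' hx
  rcases hε with rfl | rfl
  · obtain rfl : q = a + 1 := by omega
    obtain rfl : b = a + 1 + 1 := by omega
    refine ⟨a + 1, normFactorial_self _, normFactorial_self_succ _, fun x => key _ x, ?_, ?_⟩
    · have h := normFactorial_succ (a + 1) a
      rw [normFactorial_self] at h
      push_cast at h
      field_simp at h
      have h0 : (0 : ℝ) ≤ a := by positivity
      nlinarith
    · intro x hx
      rcases (show x < a ∨ x = a by omega) with h | rfl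
      · have := normFactorial_lt_of_lt_of_le h (Nat.le_succ a)
        exact ⟨this.le, fun h' => absurd h' this.ne'⟩
      · simp
  · obtain rfl : q = b + 1 := by omega
    obtain rfl : a = b + 1 + 1 := by omega
    refine ⟨b, normFactorial_self_succ _, normFactorial_self _, fun x hx => (key _ x hx).symm,
      ?_, ?_⟩
    · rw [normFactorial_succ, normFactorial_self_succ, one_mul, div_le_iff₀ (by positivity)]
      push_cast
      have h0 : (0 : ℝ) ≤ b := by positivity
      linarith
    · intro x hx
      rcases (show b + 1 + 1 < x ∨ x = b + 1 + 1 by omega) with h | rfl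
      · have := normFactorial_lt_of_le_of_lt (Nat.le_succ (b + 1)) h
        exact ⟨this.le, fun h' => absurd h' this.ne'⟩
      · simp

/-! ### Entries -/

lemma card_entries {k : ℕ} (N : Fin k → Fin k → ℕ) : (entries N).card = k ^ 2 := by
  simp [entries, sq]

lemma sum_entries {k l : ℕ} {N : Fin k → Fin k → ℕ} (hN : IsInterMatrix k l N) :
    (entries N).sum = k * l := by
  change ∑ p : Fin k × Fin k, N p.1 p.2 = k * l
  rw [Fintype.sum_prod_type]
  simp [hN.1]

lemma prod_map_factorial_entries {k : ℕ} (N : Fin k → Fin k → ℕ) :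
    ((entries N).map Nat.factorial).prod = ∏ i, ∏ j, (N i j).factorial := by
  rw [← Fintype.prod_prod_type' (f := fun i j => (N i j).factorial), entries, Multiset.map_map]
  rfl

lemma mem_entries {k : ℕ} {N : Fin k → Fin k → ℕ} {x : ℕ} :
    x ∈ entries N ↔ ∃ i j, N i j = x := by
  simp [entries]

/-- The sum of the entries determines the multiplicities of `q` and `q + ε`. -/
lemma cons_eq_replicate {k l q a b : ℕ} {ε : ℤ} (hε : ε = 1 ∨ ε = -1)
    (hlq : (l : ℤ) = q * k + 2 * ε) (ha : (a : ℤ) = q - ε) (hb : (b : ℤ) = q + ε)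
    {t : Multiset ℕ} (hcard : (a ::ₘ t).card = k ^ 2) (hsum : (a ::ₘ t).sum = k * l)
    (ht : ∀ x ∈ t, x = q ∨ x = b) :
    a ::ₘ t = Multiset.replicate 1 a + Multiset.replicate (k ^ 2 - 2 * k - 2) q +
      Multiset.replicate (2 * k + 1) b := by
  obtain ⟨n, p, rfl⟩ : ∃ n p, t = Multiset.replicate n q + Multiset.replicate p b := by
    clear hcard hsum
    induction t using Multiset.induction_on with
    | empty => exact ⟨0, 0, by simp⟩
    | cons x t ih =>
      obtain ⟨n, p, rfl⟩ := ih fun y hy => ht y (Multiset.mem_cons_of_mem hy)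
      rcases ht x (Multiset.mem_cons_self _ _) with rfl | rfl
      · exact ⟨n + 1, p, by simp [Multiset.replicate_succ]⟩
      · exact ⟨n, p + 1, by simp [Multiset.replicate_succ]⟩
  simp only [Multiset.card_cons, Multiset.card_add, Multiset.card_replicate, Multiset.sum_cons,
    Multiset.sum_add, Multiset.sum_replicate, smul_eq_mul] at hcard hsum
  have hcard' : (n : ℤ) + p + 1 = k ^ 2 := by exact_mod_cast hcard
  have hsum' : (a : ℤ) + (n * q + p * b) = k * l := by exact_mod_cast hsum
  rw [ha, hb, hlq] at hsum'
  have hp : ε * ((p : ℤ) - (2 * k + 1)) = 0 := by linear_combination hsum' - q * hcard'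
  have hp' : p = 2 * k + 1 := by rcases hε with rfl | rfl <;> omega
  have hn : n = k ^ 2 - 2 * k - 2 := by omega
  rw [hp', hn, Multiset.replicate_one, add_assoc, Multiset.singleton_add]

lemma prod_map_factorial_replicate (a b q n p : ℕ) :
    ((Multiset.replicate 1 a + Multiset.replicate n q + Multiset.replicate p b).map
      Nat.factorial).prod = a.factorial * q.factorial ^ n * b.factorial ^ p := by
  simp [mul_assoc]

/-! ### Stabilizers -/

lemma stabCard_pos {k : ℕ} (N : Fin k → Fin k → ℕ) : 0 < stabCard N := by
  have : Nonempty {p : Equiv.Perm (Fin k) × Equiv.Perm (Fin k) //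
      ∀ i j, N (p.1 i) (p.2 j) = N i j} := ⟨⟨1, fun _ _ => rfl⟩⟩
  exact Nat.card_pos

lemma stabCard_le_stabCard {k : ℕ} {M N : Fin k → Fin k → ℕ}
    (h : ∀ i j i' j', M i j = M i' j' → N i j = N i' j') : stabCard M ≤ stabCard N :=
  Nat.card_le_card_of_injective
    (fun p => ⟨p.1, fun i j => h _ _ _ _ (p.2 i j)⟩)
    fun _ _ hpp => Subtype.ext (congrArg (fun z => z.1) hpp)

/-- A permutation of at least five points commutes with two distinct nontrivial permutations. -/
lemma exists_two_commute {k : ℕ} (hk : 5 ≤ k) (π : Equiv.Perm (Fin k)) :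
    ∃ g h : Equiv.Perm (Fin k), g ≠ 1 ∧ h ≠ 1 ∧ g ≠ h ∧ Commute g π ∧ Commute h π := by
  classical
  by_cases h1 : π = 1
  · subst h1
    let x : Fin k := ⟨0, by omega⟩
    let y : Fin k := ⟨1, by omega⟩
    let z : Fin k := ⟨2, by omega⟩
    have hxy : x ≠ y := by simp [x, y]
    have hxz : x ≠ z := by simp [x, z]
    have hyz : y ≠ z := by simp [y, z]
    refine ⟨Equiv.swap x y, Equiv.swap x z, ?_, ?_, ?_, Commute.one_right _, Commute.one_right _⟩
    · rwa [Ne, Equiv.swap_eq_one_iff]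
    · rwa [Ne, Equiv.swap_eq_one_iff]
    · intro h
      have := Equiv.congr_fun h x
      simp only [Equiv.swap_apply_left] at this
      exact hyz this
  by_cases h2 : π * π = 1
  · obtain ⟨x, hx⟩ : ∃ x, π x ≠ x := by
      by_contra! h
      exact h1 (Equiv.ext h)
    have hinv : ∀ y, π (π y) = y := fun y => Equiv.congr_fun h2 y
    have hcomm : ∀ y z, Equiv.swap (π y) (π z) = Equiv.swap y z → Commute (Equiv.swap y z) π := by
      intro y z h
      have := Equiv.mul_swap_eq_swap_mul π y z
      rw [h] at this
      exact this.symm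
    by_cases h3 : Equiv.swap x (π x) = π
    · obtain ⟨y, hy⟩ : ∃ y, y ∉ ({x, π x} : Finset (Fin k)) := by
        by_contra! h
        have := Finset.card_le_card (fun y _ => h y : (univ : Finset (Fin k)) ⊆ {x, π x})
        have := Finset.card_le_two (a := x) (b := π x)
        simp at *
        omega
      obtain ⟨z, hz⟩ : ∃ z, z ∉ ({x, π x, y} : Finset (Fin k)) := by
        by_contra! h
        have := Finset.card_le_card (fun z _ => h z : (univ : Finset (Fin k)) ⊆ {x, π x, y})
        have := Finset.card_le_three (a := x) (b := π x) (c := y)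
        simp at *
        omega
      simp only [mem_insert, mem_singleton, not_or] at hy hz
      have hfix : ∀ w, w ≠ x → w ≠ π x → π w = w := by
        intro w hw hw'
        rw [← h3]
        exact Equiv.swap_apply_of_ne_of_ne hw hw'
      refine ⟨π, Equiv.swap y z, h1, ?_, ?_, Commute.refl _, hcomm _ _ ?_⟩
      · rw [Ne, Equiv.swap_eq_one_iff]
        exact Ne.symm hz.2.2
      · intro h
        have := Equiv.congr_fun h y
        rw [Equiv.swap_apply_left, hfix y hy.1 hy.2] at this
        exact hz.2.2 this.symm
      · rw [hfix y hy.1 hy.2, hfix z hz.1 hz.2.1]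
    · refine ⟨π, Equiv.swap x (π x), h1, ?_, Ne.symm h3, Commute.refl _, hcomm _ _ ?_⟩
      · rw [Ne, Equiv.swap_eq_one_iff]
        exact hx.symm
      · rw [hinv, Equiv.swap_comm]
  · refine ⟨π, π * π, h1, h2, ?_, Commute.refl _, (Commute.refl π).mul_left (Commute.refl π)⟩
    intro h
    exact h1 (by simpa using h)

/-- The Birkhoff theorem for natural matrices with all line sums equal to `2`. -/
lemma exists_perm_of_sum_eq_two {k : ℕ} {M : Fin k → Fin k → ℕ} (hM : IsInterMatrix k 2 M) :
    ∃ σ τ : Equiv.Perm (Fin k), ∀ i j,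
      M i j = (if σ i = j then 1 else 0) + (if τ i = j then 1 else 0) := by
  classical
  obtain ⟨σ, hσ⟩ : ∃ σ : Equiv.Perm (Fin k), ∀ i, 1 ≤ M i (σ i) := by
    let A : Matrix (Fin k) (Fin k) ℝ := fun i j => (M i j : ℝ) / 2
    have hA : A ∈ doublyStochastic ℝ (Fin k) := by
      rw [mem_doublyStochastic_iff_sum]
      refine ⟨fun i j => by positivity, fun i => ?_, fun j => ?_⟩
      · simp only [A]
        rw [← Finset.sum_div, ← Nat.cast_sum, hM.1 i]
        norm_num
      · simp only [A]
        rw [← Finset.sum_div, ← Nat.cast_sum, hM.2 j]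
        norm_num
    obtain ⟨w, hw, hw1, hwA⟩ := exists_eq_sum_perm_of_mem_doublyStochastic hA
    obtain ⟨σ, -, hσ⟩ : ∃ σ ∈ (univ : Finset (Equiv.Perm (Fin k))), 0 < w σ := by
      by_contra! h
      have := Finset.sum_nonpos h
      linarith
    refine ⟨σ, fun i => ?_⟩
    by_contra! h0
    have hAi : A i (σ i) = 0 := by simp [A, Nat.lt_one_iff.mp h0]
    rw [← hwA, Matrix.sum_apply] at hAi
    rw [Finset.sum_eq_zero_iff_of_nonneg] at hAi
    · have := hAi σ (mem_univ _)
      simp [Equiv.Perm.permMatrix, PEquiv.toMatrix_apply] at this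
      exact hσ.ne' this
    · intro τ _
      simp only [Matrix.smul_apply, smul_eq_mul, Equiv.Perm.permMatrix, PEquiv.toMatrix_apply]
      exact mul_nonneg (hw τ) (by split_ifs <;> norm_num)
  let R : Fin k → Fin k → ℕ := fun i j => M i j - if σ i = j then 1 else 0
  have hR : ∀ i j, M i j = (if σ i = j then 1 else 0) + R i j := by
    intro i j
    simp only [R]
    split_ifs with h
    · have := hσ i
      rw [h] at this
      omega
    · omega
  have hrow : ∀ i, ∑ j, R i j = 1 := by
    intro i
    have := hM.1 i
    simp only [hR, sum_add_distrib, sum_ite_eq, mem_univ, if_true] at this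
    omega
  have hcol : ∀ j, ∑ i, R i j = 1 := by
    intro j
    have := hM.2 j
    have h1 : ∑ i, (if σ i = j then 1 else 0) = 1 := by
      simp [← Equiv.eq_symm_apply]
    simp only [hR, sum_add_distrib, h1] at this
    omega
  have hex : ∀ i, ∃ j, 1 ≤ R i j := by
    intro i
    by_contra! h
    have := hrow i
    rw [Finset.sum_eq_zero fun j _ => Nat.lt_one_iff.mp (h j)] at this
    omega
  choose t ht using hex
  have hinj : Function.Injective t := by
    intro i i' hii
    by_contra hne
    have h1 := Finset.sum_le_sum_of_subset (f := fun x => R x (t i)) (subset_univ {i, i'})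
    rw [Finset.sum_pair hne, hcol] at h1
    have h2 := ht i
    have h3 := ht i'
    rw [← hii] at h3
    omega
  refine ⟨σ, Equiv.ofBijective t (Finite.injective_iff_bijective.mp hinj), fun i j => ?_⟩
  rw [hR, Equiv.ofBijective_apply]
  congr 1
  split_ifs with h
  · have h1 := Finset.single_le_sum (f := fun x => R i x) (fun _ _ => Nat.zero_le _) (mem_univ j)
    rw [hrow] at h1
    have h2 := ht i
    rw [h] at h2
    exact le_antisymm h1 h2
  · have h1 := Finset.sum_le_sum_of_subset (f := fun x => R i x) (subset_univ {t i, j})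
    rw [Finset.sum_pair h, hrow] at h1
    have h2 := ht i
    omega

lemma three_le_stabCard {k : ℕ} (hk : 5 ≤ k) {M : Fin k → Fin k → ℕ} (hM : IsInterMatrix k 2 M) :
    3 ≤ stabCard M := by
  classical
  obtain ⟨σ, τ, hστ⟩ := exists_perm_of_sum_eq_two hM
  obtain ⟨g, h, hg, hh, hgh, hgc, hhc⟩ := exists_two_commute hk (σ⁻¹ * τ)
  have key : ∀ c : Equiv.Perm (Fin k), Commute c (σ⁻¹ * τ) →
      ∀ i j, M (c i) ((σ * c * σ⁻¹) j) = M i j := by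
    intro c hc i j
    have h1 : ∀ i, τ (c i) = (σ * c * σ⁻¹) (τ i) := by
      intro i
      have := Equiv.congr_fun hc.eq i
      simp only [Equiv.Perm.mul_apply] at this ⊢
      rw [this]
      simp
    have h2 : ∀ i, σ (c i) = (σ * c * σ⁻¹) (σ i) := by
      intro i
      simp
    rw [hστ, hστ, h1, h2]
    simp only [EmbeddingLike.apply_eq_iff_eq]
  let f : ({1, g, h} : Finset (Equiv.Perm (Fin k))) →
      {p : Equiv.Perm (Fin k) × Equiv.Perm (Fin k) // ∀ i j, M (p.1 i) (p.2 j) = M i j} :=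
    fun c => ⟨(c.1, σ * c.1 * σ⁻¹), key c.1 (by
      obtain ⟨c, hc⟩ := c
      simp only [mem_insert, mem_singleton] at hc
      rcases hc with rfl | rfl | rfl
      exacts [Commute.one_left _, hgc, hhc])⟩
  have hf : Function.Injective f := fun c c' hcc =>
    Subtype.ext (congrArg (fun z => z.1.1) hcc)
  have := Nat.card_le_card_of_injective f hf
  rw [Nat.card_eq_fintype_card, Fintype.card_coe, Finset.card_insert_of_notMem,
    Finset.card_pair hgh] at this
  · exact this
  · simp [hg.symm, hh.symm]

/-! ### An asymmetric matrix -/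

/-- The signed incidence pattern of three paths with `1`, `2` and `k - 4` interior rows joining
row `0` to column `0`, with entry `-1` at `(0, 0)`. -/
def thetaPattern (k i j : ℕ) : ℤ :=
  if i = 0 then (if j = 0 then -1 else if j = 1 ∨ j = 2 ∨ j = 4 then 1 else 0)
  else if j = i ∨ j = (if i = 1 ∨ i = 3 ∨ i = k - 1 then 0 else i + 1) then 1 else 0

lemma sum_fin_ite_eq {k c : ℕ} (hc : c < k) :
    ∑ j : Fin k, (if (j : ℕ) = c then (1 : ℤ) else 0) = 1 := by
  rw [Finset.sum_eq_single (⟨c, hc⟩ : Fin k)]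
  · simp
  · intro j _ hj
    rw [if_neg]
    exact fun h => hj (Fin.ext h)
  · simp

lemma sum_thetaPattern_row {k : ℕ} (hk : 7 ≤ k) (i : Fin k) :
    ∑ j : Fin k, thetaPattern k i j = 2 := by
  obtain ⟨i, hi⟩ := i
  by_cases h0 : i = 0
  · have : ∀ j : Fin k, thetaPattern k i j = (if (j : ℕ) = 1 then 1 else 0) +
        (if (j : ℕ) = 2 then 1 else 0) + (if (j : ℕ) = 4 then 1 else 0) -
        (if (j : ℕ) = 0 then 1 else 0) := by
      intro j
      unfold thetaPattern
      grind
    simp only [this, sum_add_distrib, sum_sub_distrib]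
    rw [sum_fin_ite_eq (by omega), sum_fin_ite_eq (by omega), sum_fin_ite_eq (by omega),
      sum_fin_ite_eq (by omega)]
    norm_num
  · have : ∀ j : Fin k, thetaPattern k i j = (if (j : ℕ) = i then 1 else 0) +
        (if (j : ℕ) = (if i = 1 ∨ i = 3 ∨ i = k - 1 then 0 else i + 1) then 1 else 0) := by
      intro j
      unfold thetaPattern
      grind
    simp only [this, sum_add_distrib]
    rw [sum_fin_ite_eq (by omega), sum_fin_ite_eq (by grind)]
    norm_num

lemma sum_thetaPattern_col {k : ℕ} (hk : 7 ≤ k) (j : Fin k) :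
    ∑ i : Fin k, thetaPattern k i j = 2 := by
  obtain ⟨j, hj⟩ := j
  by_cases h0 : j = 0
  · have : ∀ i : Fin k, thetaPattern k i j = (if (i : ℕ) = 1 then 1 else 0) +
        (if (i : ℕ) = 3 then 1 else 0) + (if (i : ℕ) = k - 1 then 1 else 0) -
        (if (i : ℕ) = 0 then 1 else 0) := by
      intro i
      unfold thetaPattern
      grind
    simp only [this, sum_add_distrib, sum_sub_distrib]
    rw [sum_fin_ite_eq (by omega), sum_fin_ite_eq (by omega), sum_fin_ite_eq (by omega),
      sum_fin_ite_eq (by omega)]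
    norm_num
  · have : ∀ i : Fin k, thetaPattern k i j = (if (i : ℕ) = j then 1 else 0) +
        (if (i : ℕ) = (if j = 1 ∨ j = 2 ∨ j = 4 then 0 else j - 1) then 1 else 0) := by
      intro i
      have := i.2
      unfold thetaPattern
      grind
    simp only [this, sum_add_distrib]
    rw [sum_fin_ite_eq (by omega), sum_fin_ite_eq (by grind)]
    norm_num

/-- The pattern has trivial stabilizer. -/
lemma thetaPattern_rigid {k : ℕ} (hk : 7 ≤ k) {g h : ℕ → ℕ}
    (hg : ∀ i < k, ∀ i' < k, g i = g i' → i = i') (hh : ∀ i < k, ∀ i' < k, h i = h i' → i = i')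
    (hgk : ∀ i < k, g i < k)
    (hgh : ∀ i < k, ∀ j < k, thetaPattern k (g i) (h j) = thetaPattern k i j) :
    ∀ i < k, g i = i ∧ h i = i := by
  have hneg : ∀ i j, thetaPattern k i j = -1 → i = 0 ∧ j = 0 := by
    intro i j
    unfold thetaPattern
    grind
  have hcol : ∀ i < k, ∀ j, j ≠ 0 → thetaPattern k i j = 1 →
      i = j ∨ i = (if j = 1 ∨ j = 2 ∨ j = 4 then 0 else j - 1) := by
    intro i hi j hj
    unfold thetaPattern
    grind
  have hrow : ∀ i j, i ≠ 0 → thetaPattern k i j = 1 →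
      j = i ∨ j = (if i = 1 ∨ i = 3 ∨ i = k - 1 then 0 else i + 1) := by
    intro i j hi
    unfold thetaPattern
    grind
  have hrow0 : ∀ j, thetaPattern k 0 j = 1 → j = 1 ∨ j = 2 ∨ j = 4 := by
    intro j
    unfold thetaPattern
    grind
  have hcol0 : ∀ i, thetaPattern k i 0 = 1 → i = 1 ∨ i = 3 ∨ i = k - 1 := by
    intro i
    unfold thetaPattern
    grind
  have hdiag : ∀ i, i ≠ 0 → thetaPattern k i i = 1 := by
    intro i hi
    simp [thetaPattern, hi]
  have hsucc : ∀ i, i ≠ 0 → i ≠ 1 → i ≠ 3 → i + 1 < k → thetaPattern k i (i + 1) = 1 := by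
    intro i
    unfold thetaPattern
    grind
  obtain ⟨hg0, hh0⟩ : g 0 = 0 ∧ h 0 = 0 :=
    hneg _ _ ((hgh 0 (by omega) 0 (by omega)).trans (by simp [thetaPattern]))
  have hgd : ∀ i < k, i ≠ 0 → thetaPattern k (g i) (h i) = 1 := fun i hi h0 =>
    (hgh i hi i hi).trans (hdiag i h0)
  have hh1 : h 1 = 1 := by
    have e1 := hrow0 (h 1) (by rw [← hg0, hgh 0 (by omega) 1 (by omega)]; simp [thetaPattern])
    have e2 := hcol _ (hgk 1 (by omega)) _ (by omega) (hgd 1 (by omega) (by omega))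
    have e3 := hcol0 (g 1) (by rw [← hh0, hgh 1 (by omega) 0 (by omega)]; simp [thetaPattern])
    have e4 := hg 1 (by omega) 0 (by omega)
    grind
  have hh2 : h 2 = 2 := by
    have e1 := hrow0 (h 2) (by rw [← hg0, hgh 0 (by omega) 2 (by omega)]; simp [thetaPattern])
    have e0 := hh 2 (by omega) 1 (by omega)
    by_contra hne
    have h24 : h 2 = 4 := by omega
    have e2 := hcol _ (hgk 2 (by omega)) _ (by omega) (hgd 2 (by omega) (by omega))
    have e3 := hg 2 (by omega) 0 (by omega)
    have g24 : g 2 = 4 := by grind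
    have e4 := hrow (g 2) (h 3) (by omega)
      ((hgh 2 (by omega) 3 (by omega)).trans (hsucc 2 (by omega) (by omega) (by omega) (by omega)))
    have e5 := hh 3 (by omega) 2 (by omega)
    have h35 : h 3 = 5 := by grind
    have e6 := hcol _ (hgk 3 (by omega)) _ (by omega) (hgd 3 (by omega) (by omega))
    have e7 := hg 3 (by omega) 2 (by omega)
    have g35 : g 3 = 5 := by grind
    have e8 := hcol0 (g 3) (by rw [← hh0, hgh 3 (by omega) 0 (by omega)]; simp [thetaPattern])
    omega
  have hh4 : h 4 = 4 := by
    have e1 := hrow0 (h 4) (by rw [← hg0, hgh 0 (by omega) 4 (by omega)]; simp [thetaPattern])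
    have e2 := hh 4 (by omega) 1 (by omega)
    have e3 := hh 4 (by omega) 2 (by omega)
    omega
  intro i
  induction i with
  | zero => exact fun _ => ⟨hg0, hh0⟩
  | succ i ih =>
    intro hi
    obtain ⟨ihg, ihh⟩ := ih (by omega)
    have hhi : h (i + 1) = i + 1 := by
      by_cases h1 : i = 0
      · rwa [h1]
      by_cases h2 : i = 1
      · rwa [h2]
      by_cases h3 : i = 3
      · rwa [h3]
      have e1 := hrow (g i) (h (i + 1)) (by omega)
        ((hgh i (by omega) (i + 1) hi).trans (hsucc i h1 h2 h3 hi))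
      have e2 := hh (i + 1) hi i (by omega)
      grind
    refine ⟨?_, hhi⟩
    have e1 := hcol _ (hgk (i + 1) hi) _ (by omega) (hgd (i + 1) hi (by omega))
    have e2 := hg (i + 1) hi i (by omega)
    have e3 := hg (i + 1) hi 0 (by omega)
    grind

/-- The entry of the extremal matrix with deviation `d` from `q`. -/
def deviationEntry (a q b : ℕ) (d : ℤ) : ℕ :=
  if d = -1 then a else if d = 1 then b else q

lemma exists_asymmetric {k l q a b : ℕ} {ε : ℤ} (hk : 7 ≤ k) (hε : ε = 1 ∨ ε = -1)
    (hlq : (l : ℤ) = q * k + 2 * ε) (ha : (a : ℤ) = q - ε) (hb : (b : ℤ) = q + ε) :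
    ∃ N : Fin k → Fin k → ℕ, IsInterMatrix k l N ∧ stabCard N = 1 ∧
      ∃ t : Multiset ℕ, entries N = a ::ₘ t ∧ ∀ x ∈ t, x = q ∨ x = b := by
  have hval : ∀ i j, thetaPattern k i j = -1 ∨ thetaPattern k i j = 0 ∨
      thetaPattern k i j = 1 := by
    intro i j
    unfold thetaPattern
    grind
  have hcast : ∀ i j, (deviationEntry a q b (thetaPattern k i j) : ℤ) =
      q + ε * thetaPattern k i j := by
    intro i j
    rcases hval i j with h | h | h <;> simp [deviationEntry, h, ha, hb]
    ring
  have hε0 : ε ≠ 0 := by omega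
  refine ⟨fun i j => deviationEntry a q b (thetaPattern k i j), ⟨fun i => ?_, fun j => ?_⟩, ?_, ?_⟩
  · zify
    simp only [hcast, sum_add_distrib, ← mul_sum, sum_thetaPattern_row hk]
    simp only [sum_const, card_univ, Fintype.card_fin, nsmul_eq_mul]
    linear_combination -hlq
  · zify
    simp only [hcast, sum_add_distrib, ← mul_sum, sum_thetaPattern_col hk]
    simp only [sum_const, card_univ, Fintype.card_fin, nsmul_eq_mul]
    linear_combination -hlq
  · rw [stabCard, Nat.card_eq_one_iff_unique]
    refine ⟨⟨?_⟩, ⟨⟨1, fun _ _ => rfl⟩⟩⟩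
    suffices H : ∀ p : {p : Equiv.Perm (Fin k) × Equiv.Perm (Fin k) //
        ∀ i j, deviationEntry a q b (thetaPattern k (p.1 i) (p.2 j)) =
          deviationEntry a q b (thetaPattern k i j)}, p.1 = 1 from
      fun p p' => Subtype.ext ((H p).trans (H p').symm)
    rintro ⟨⟨g, h⟩, hgh⟩
    have hgh' : ∀ i j, thetaPattern k (g i) (h j) = thetaPattern k i j := by
      intro i j
      have := congrArg (fun n : ℕ => (n : ℤ)) (hgh i j)
      simp only [hcast] at this
      exact mul_left_cancel₀ hε0 (add_left_cancel this)
    let ext : Equiv.Perm (Fin k) → ℕ → ℕ := fun c i => if hi : i < k then c ⟨i, hi⟩ else i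
    have hext : ∀ (c : Equiv.Perm (Fin k)) i (hi : i < k), ext c i = c ⟨i, hi⟩ := by
      intro c i hi
      simp [ext, hi]
    have hinj : ∀ c : Equiv.Perm (Fin k), ∀ i < k, ∀ i' < k, ext c i = ext c i' → i = i' := by
      intro c i hi i' hi' hii
      rw [hext c i hi, hext c i' hi'] at hii
      simpa using c.injective (Fin.ext hii)
    have := thetaPattern_rigid hk (hinj g) (hinj h)
      (fun i hi => by rw [hext g i hi]; exact (g _).2)
      (fun i hi j hj => by rw [hext g i hi, hext h j hj]; exact hgh' _ _)
    ext i
    · have := (this i i.2).1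
      rwa [hext g i i.2] at this
    · have := (this i i.2).2
      rwa [hext h i i.2] at this
  · let z : Fin k := ⟨0, by omega⟩
    refine ⟨((univ.erase (z, z)).val.map fun p : Fin k × Fin k =>
      deviationEntry a q b (thetaPattern k p.1 p.2)), ?_, ?_⟩
    · rw [entries, ← Finset.insert_erase (mem_univ (z, z)),
        Finset.insert_val_of_notMem (Finset.notMem_erase _ _), Multiset.map_cons]
      congr 1
      · simp
    · intro x hx
      simp only [Multiset.mem_map, Finset.mem_val, mem_erase] at hx
      obtain ⟨⟨i, j⟩, ⟨hij, -⟩, rfl⟩ := hx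
      rcases hval i j with h | h | h
      · exfalso
        apply hij
        have : (i : ℕ) = 0 ∧ (j : ℕ) = 0 := by
          unfold thetaPattern at h
          grind
        exact Prod.ext (Fin.ext this.1) (Fin.ext this.2)
      · left
        simp [deviationEntry, h]
      · right
        simp [deviationEntry, h]

/-! ### The lower bound -/

/-- The lower bound on the order of the automorphism group, with the equality case. -/
lemma le_autCard {k l q a b : ℕ} {ε : ℤ} (hk : 7 ≤ k) (hε : ε = 1 ∨ ε = -1)
    (hlq : (l : ℤ) = q * k + 2 * ε) (ha : (a : ℤ) = q - ε) (hb : (b : ℤ) = q + ε)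
    {T : Multiset ℕ} (hT : T = Multiset.replicate 1 a +
      Multiset.replicate (k ^ 2 - 2 * k - 2) q + Multiset.replicate (2 * k + 1) b)
    (hTcard : T.card = k ^ 2) (hTsum : T.sum = k * l)
    {N : Fin k → Fin k → ℕ} (hN : IsInterMatrix k l N) :
    (T.map Nat.factorial).prod ≤ autCard N ∧
      (autCard N = (T.map Nat.factorial).prod → stabCard N = 1 ∧ entries N = T) := by
  obtain ⟨m, hq1, hb1, hone, ha2, hfar⟩ := exists_normFactorial_minimisers hε ha hb
  have hTprod : (T.map (normFactorial m)).prod = normFactorial m a := by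
    simp [hT, hq1, hb1]
  have hNprod := prod_map_normFactorial m (entries N)
  rw [prod_map_normFactorial, hTcard, hTsum] at hTprod
  rw [card_entries, sum_entries hN] at hNprod
  set c : ℝ := (((m : ℝ) + 1) ^ m / m.factorial) ^ k ^ 2 / ((m : ℝ) + 1) ^ (k * l) with hc
  have hc0 : 0 < c := by positivity
  have haut : autCard N = stabCard N * ((entries N).map Nat.factorial).prod := by
    rw [prod_map_factorial_entries, autCard]
  set P := ((entries N).map Nat.factorial).prod
  set Q := (T.map Nat.factorial).prod
  have hP0 : 0 < P := by
    refine Nat.pos_of_ne_zero fun h => ?_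
    simp only [P, Multiset.prod_eq_zero_iff, Multiset.mem_map] at h
    obtain ⟨x, -, hx⟩ := h
    exact Nat.factorial_ne_zero x hx
  rw [haut]
  by_cases hcase : ∃ x ∈ entries N, ε * ((x : ℤ) - q) < 0
  · obtain ⟨x, hx, hxq⟩ := hcase
    obtain ⟨hax, hxa⟩ := hfar x hxq
    obtain ⟨t, ht⟩ := Multiset.exists_cons_of_mem hx
    rw [ht, Multiset.map_cons, Multiset.prod_cons] at hNprod
    have ht1 := one_le_prod_map_normFactorial m t
    have ha0 := normFactorial_pos m a
    have hQP : Q ≤ P := by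
      have : (Q : ℝ) * c ≤ P * c := by
        rw [hTprod, ← hNprod]
        nlinarith
      exact_mod_cast le_of_mul_le_mul_right this hc0
    have hs := stabCard_pos N
    refine ⟨hQP.trans (Nat.le_mul_of_pos_left _ hs), fun heq => ?_⟩
    have hs1 : stabCard N = 1 := by nlinarith
    rw [hs1, one_mul] at heq
    refine ⟨hs1, ?_⟩
    rw [heq, hTprod] at hNprod
    have hxa' : normFactorial m x = normFactorial m a := by nlinarith
    have ht1' : (t.map (normFactorial m)).prod = 1 := by
      rw [hxa'] at hNprod
      exact (mul_eq_left₀ ha0.ne').mp hNprod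
    obtain rfl := hxa hxa'
    rw [ht, hT]
    refine cons_eq_replicate hε hlq ha hb ?_ ?_ fun y hy =>
      hone y (normFactorial_eq_one_of_prod_map_eq_one ht1' y hy)
    · rw [← ht, card_entries]
    · rw [← ht, sum_entries hN]
  · push Not at hcase
    have hnn : ∀ i j, 0 ≤ ε * ((N i j : ℤ) - q) := fun i j =>
      hcase _ (mem_entries.mpr ⟨i, j, rfl⟩)
    let M : Fin k → Fin k → ℕ := fun i j => (ε * ((N i j : ℤ) - q)).toNat
    have hMcast : ∀ i j, (M i j : ℤ) = ε * ((N i j : ℤ) - q) := fun i j =>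
      Int.toNat_of_nonneg (hnn i j)
    have hε2 : ε * ε = 1 := by rcases hε with rfl | rfl <;> norm_num
    have hM : IsInterMatrix k 2 M := by
      refine ⟨fun i => ?_, fun j => ?_⟩
      · have := congrArg (fun n : ℕ => (n : ℤ)) (hN.1 i)
        push_cast at this
        zify
        simp only [hMcast, ← mul_sum, sum_sub_distrib, this]
        simp only [sum_const, card_univ, Fintype.card_fin, nsmul_eq_mul]
        linear_combination ε * hlq + 2 * hε2
      · have := congrArg (fun n : ℕ => (n : ℤ)) (hN.2 j)
        push_cast at this
        zify
        simp only [hMcast, ← mul_sum, sum_sub_distrib, this]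
        simp only [sum_const, card_univ, Fintype.card_fin, nsmul_eq_mul]
        linear_combination ε * hlq + 2 * hε2
    have hstab : 3 ≤ stabCard N := by
      refine (three_le_stabCard (by omega) hM).trans (stabCard_le_stabCard ?_)
      intro i j i' j' h
      have h' := congrArg (fun n : ℕ => (n : ℤ)) h
      simp only [hMcast] at h'
      rcases hε with rfl | rfl <;> omega
    have hQP : Q ≤ 2 * P := by
      have : (Q : ℝ) * c ≤ (2 * P) * c := by
        have := one_le_prod_map_normFactorial m (entries N)
        rw [hNprod] at this
        rw [hTprod]
        linarith
      exact_mod_cast le_of_mul_le_mul_right this hc0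
    have hlt : Q < stabCard N * P := by nlinarith
    exact ⟨hlt.le, fun h => absurd h.symm hlt.ne⟩

/-- χ(k,l) for l = qk + 2ε with ε = ±1, k ≥ 7, together with the structure of the
minimising matrices.  Here `a = q − ε` and `b = q + ε` as natural numbers. -/
theorem chi_pm_two (k l q : ℕ) (ε : ℤ) (hk : 7 ≤ k) (hl : 2 < l)
    (hε : ε = 1 ∨ ε = -1) (hlq : (l : ℤ) = q * k + 2 * ε)
    (a b : ℕ) (ha : (a : ℤ) = q - ε) (hb : (b : ℤ) = q + ε) :
    IsLeast {m | ∃ N : Fin k → Fin k → ℕ, IsInterMatrix k l N ∧ m = autCard N}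
      (a.factorial * q.factorial ^ (k ^ 2 - 2 * k - 2) * b.factorial ^ (2 * k + 1)) ∧
    ∀ N : Fin k → Fin k → ℕ, IsInterMatrix k l N →
      autCard N = a.factorial * q.factorial ^ (k ^ 2 - 2 * k - 2) * b.factorial ^ (2 * k + 1) →
      stabCard N = 1 ∧
        entries N = Multiset.replicate 1 a + Multiset.replicate (k ^ 2 - 2 * k - 2) q +
          Multiset.replicate (2 * k + 1) b := by
  obtain ⟨N, hN, hstab, t, ht, htv⟩ := exists_asymmetric hk hε hlq ha hb
  have hNcard := card_entries N
  have hNsum := sum_entries hN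
  rw [ht] at hNcard hNsum
  have hT := cons_eq_replicate hε hlq ha hb hNcard hNsum htv
  rw [hT] at hNcard hNsum
  have hbound := fun (N' : Fin k → Fin k → ℕ) (hN' : IsInterMatrix k l N') =>
    le_autCard hk hε hlq ha hb rfl hNcard hNsum hN'
  rw [prod_map_factorial_replicate] at hbound
  refine ⟨⟨⟨N, hN, ?_⟩, ?_⟩, fun N' hN' => (hbound N' hN').2⟩
  · rw [autCard, hstab, one_mul, ← prod_map_factorial_entries, ht, hT,
      prod_map_factorial_replicate]
  · rintro _ ⟨N', hN', rfl⟩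
    exact (hbound N' hN').1
end

section
/- Let k ≥ 7 and q ≥ 1 be integers with l = qk > 2. Then the minimum over all (k,l)-intersection matrices N of |K_N| · ∏_{i,j} N_{i,j}! equals (q+1)!^k · q!^{k²−2k} · (q−1)!^k; that is, χ(k,qk) = (q+1)!^k q!^{k²−2k} (q−1)!^k. Moreover, every (k,l)-intersection matrix N attaining this minimum satisfies one of: (a) K_N is trivial and the multiset of entries of N consists of k entries equal to q+1, k²−2k entries equal to q, and k entries equal to q−1; or (b) l = k (i.e., q = 1), |K_N| = 2, and the multiset of entries of N consists of k−1 entries equal to 2, k²−2k+2 entries equal to 1, and k−1 entries equal to 0. -/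
section Auxiliary

open Finset Equiv

section Line

variable {k q : ℕ} {f : Fin k → ℕ}

lemma sum_excess_eq_sum_deficit (h : ∑ j, f j = q * k) :
    ∑ j, (f j - q) = ∑ j, (q - f j) := by
  have h1 : ∑ j, (f j + (q - f j)) = ∑ j : Fin k, (q + (f j - q)) :=
    sum_congr rfl fun j _ => by omega
  rw [sum_add_distrib, sum_add_distrib, h, sum_const, card_univ, Fintype.card_fin,
    smul_eq_mul, mul_comm k q] at h1
  omega

lemma eq_of_sum_excess_eq_zero (h : ∑ j, f j = q * k) (h0 : ∑ j, (f j - q) = 0) (j : Fin k) :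
    f j = q := by
  have h1 := sum_excess_eq_sum_deficit h ▸ h0
  have h2 := (sum_eq_zero_iff.1 h0) j (mem_univ j)
  have h3 := (sum_eq_zero_iff.1 h1) j (mem_univ j)
  omega

lemma exists_single_of_sum_eq_one {g : Fin k → ℕ} (h : ∑ j, g j = 1) :
    ∃ a, ∀ j, g j = if j = a then 1 else 0 := by
  obtain ⟨a, -, ha⟩ := exists_ne_zero_of_sum_ne_zero (h ▸ one_ne_zero : ∑ j, g j ≠ 0)
  refine ⟨a, fun j => ?_⟩
  have h1 := add_sum_erase univ g (mem_univ a)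
  split_ifs with hj
  · subst hj; omega
  · have := single_le_sum (f := g) (fun _ _ => Nat.zero_le _) (mem_erase.2 ⟨hj, mem_univ j⟩)
    omega

/-- A line of excess one has a single entry `q + 1`, a single entry `q - 1`, and all other
entries equal to `q`. -/
lemma exists_form_of_sum_excess_eq_one (h : ∑ j, f j = q * k) (h1 : ∑ j, (f j - q) = 1) :
    ∃ a b, ∀ j, f j + (if j = b then 1 else 0) = q + (if j = a then 1 else 0) := by
  obtain ⟨a, ha⟩ := exists_single_of_sum_eq_one h1
  obtain ⟨b, hb⟩ := exists_single_of_sum_eq_one (sum_excess_eq_sum_deficit h ▸ h1)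
  exact ⟨a, b, fun j => by rw [← ha, ← hb]; omega⟩

end Line

section Factorial

lemma factorial_add_le_factorial_mul_pow (n m : ℕ) :
    (n + m).factorial ≤ n.factorial * (n + m) ^ m := by
  rw [← Nat.factorial_mul_ascFactorial]
  exact Nat.mul_le_mul_left _ (Nat.ascFactorial_le_pow_add n m)

lemma factorial_entry_le {q : ℕ} (n : ℕ) :
    q.factorial * (q + 1) ^ (n - q) ≤ n.factorial * q ^ (q - n) := by
  rcases le_total q n with h | h
  · obtain ⟨p, rfl⟩ := Nat.exists_eq_add_of_le h
    simpa using Nat.factorial_mul_pow_le_factorial (m := q) (n := p)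
  · obtain ⟨m, rfl⟩ := Nat.exists_eq_add_of_le h
    simpa using factorial_add_le_factorial_mul_pow n m

lemma factorial_entry_eq {q n : ℕ} (hq : 1 ≤ q)
    (h : n.factorial * q ^ (q - n) ≤ q.factorial * (q + 1) ^ (n - q)) :
    n = q + 1 ∨ n = q ∨ n = q - 1 := by
  by_contra! hn
  obtain ⟨h1, h2, h3⟩ := hn
  rcases lt_or_gt_of_ne h2 with h4 | h4
  · obtain ⟨m, rfl⟩ : ∃ m, q = n + 1 + m + 1 := ⟨q - n - 2, by omega⟩
    have e1 : n + 1 + m + 1 - n = m + 2 := by omega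
    have e2 : n - (n + 1 + m + 1) = 0 := by omega
    rw [e1, e2, pow_zero, mul_one, Nat.factorial_succ] at h
    have h5 : (n + 1 + m).factorial ≤ n.factorial * (n + 1 + m) ^ (m + 1) := by
      have := factorial_add_le_factorial_mul_pow n (m + 1)
      rwa [show n + (m + 1) = n + 1 + m by omega] at this
    have h6 : (n + 1 + m) ^ (m + 1) < (n + 1 + m + 1) ^ (m + 1) :=
      Nat.pow_lt_pow_left (by omega) (by omega)
    have h7 := Nat.mul_lt_mul_of_pos_left h6 n.factorial_pos
    have h8 : (n + 1 + m + 1) * (n + 1 + m).factorial <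
        (n + 1 + m + 1) * (n.factorial * (n + 1 + m + 1) ^ (m + 1)) :=
      Nat.mul_lt_mul_of_pos_left (h5.trans_lt h7) (by omega)
    refine absurd h (not_le.2 (h8.trans_eq ?_))
    ring
  · obtain ⟨m, rfl⟩ : ∃ m, n = q + 1 + m + 1 := ⟨n - q - 2, by omega⟩
    have e1 : q + 1 + m + 1 - q = m + 2 := by omega
    have e2 : q - (q + 1 + m + 1) = 0 := by omega
    rw [e1, e2, pow_zero, mul_one, Nat.factorial_succ] at h
    have h5 : q.factorial * (q + 1) ^ (m + 1) ≤ (q + 1 + m).factorial := by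
      have := Nat.factorial_mul_pow_le_factorial (m := q) (n := m + 1)
      rwa [show q + (m + 1) = q + 1 + m by omega] at this
    have h8 : q.factorial * (q + 1) ^ (m + 1) * (q + 1) <
        (q + 1 + m).factorial * (q + 1 + m + 1) :=
      Nat.mul_lt_mul_of_le_of_lt h5 (by omega) (Nat.factorial_pos _)
    refine absurd h (not_le.2 ?_)
    calc _ = q.factorial * (q + 1) ^ (m + 1) * (q + 1) := by ring
      _ < _ := h8
      _ = _ := by ring

lemma two_pow_lt_factorial_mul_factorial {t : ℕ} (ht : 3 ≤ t) :
    2 ^ t < t.factorial * t.factorial := by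
  induction t, ht using Nat.le_induction with
  | base => decide
  | succ n hn ih =>
    rw [Nat.factorial_succ, pow_succ]
    nlinarith [Nat.zero_le (n * n.factorial * n.factorial), n.factorial_pos,
      mul_pos n.factorial_pos n.factorial_pos]

end Factorial

section Stabilizer

variable {k q : ℕ} {N : Fin k → Fin k → ℕ}

/-- The total excess of the entries of `N` over `q`. -/
def excess (q : ℕ) (N : Fin k → Fin k → ℕ) : ℕ := ∑ i, ∑ j, (N i j - q)

/-- The set of rows of `N` that are not constantly `q`. -/
noncomputable def activeRows (q : ℕ) (N : Fin k → Fin k → ℕ) : Finset (Fin k) :=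
  {i | ∃ j, N i j ≠ q}

lemma mem_activeRows {i : Fin k} : i ∈ activeRows q N ↔ ∃ j, N i j ≠ q := by
  simp [activeRows]

lemma notMem_activeRows {i : Fin k} : i ∉ activeRows q N ↔ ∀ j, N i j = q := by
  simp [activeRows]

lemma IsInterMatrix.transpose {l : ℕ} (h : IsInterMatrix k l N) :
    IsInterMatrix k l (fun i j => N j i) := ⟨h.2, h.1⟩

lemma excess_transpose : excess q (fun i j => N j i) = excess q N := sum_comm

lemma one_le_sum_excess (h : IsInterMatrix k (q * k) N) {i : Fin k} (hi : i ∈ activeRows q N) :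
    1 ≤ ∑ j, (N i j - q) := by
  by_contra! h0
  obtain ⟨j, hj⟩ := mem_activeRows.1 hi
  exact hj (eq_of_sum_excess_eq_zero (h.1 i) (by omega) j)

lemma excess_eq_sum_activeRows : excess q N = ∑ i ∈ activeRows q N, ∑ j, (N i j - q) := by
  refine (sum_subset (subset_univ _) fun i _ hi => ?_).symm
  exact sum_eq_zero fun j _ => by rw [notMem_activeRows.1 hi j, Nat.sub_self]

lemma card_activeRows_le_excess (h : IsInterMatrix k (q * k) N) :
    #(activeRows q N) ≤ excess q N := by
  rw [excess_eq_sum_activeRows, card_eq_sum_ones]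
  exact sum_le_sum fun i hi => one_le_sum_excess h hi

lemma sum_excess_eq_one (h : IsInterMatrix k (q * k) N) (hs : #(activeRows q N) = excess q N)
    {i : Fin k} (hi : i ∈ activeRows q N) : ∑ j, (N i j - q) = 1 := by
  rw [excess_eq_sum_activeRows, card_eq_sum_ones] at hs
  exact ((sum_eq_sum_iff_of_le fun i hi => one_le_sum_excess h hi).1 hs i hi).symm

/-- Permutations of the constant rows and of the constant columns stabilize the matrix. -/
lemma ofSubtype_stabilizes
    (p : Perm {i // i ∉ activeRows q N} × Perm {j // j ∉ activeRows q fun i j => N j i})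
    (i j : Fin k) : N (Perm.ofSubtype p.1 i) (Perm.ofSubtype p.2 j) = N i j := by
  have hcol : ∀ i, N i (Perm.ofSubtype p.2 j) = N i j := fun i => by
    by_cases hj : j ∉ activeRows q fun i j => N j i
    · rw [Perm.ofSubtype_apply_of_mem p.2 hj, notMem_activeRows.1 hj i]
      exact notMem_activeRows.1 (p.2 ⟨j, hj⟩).2 i
    · rw [Perm.ofSubtype_apply_of_not_mem p.2 hj]
  rw [hcol]
  by_cases hi : i ∉ activeRows q N
  · rw [Perm.ofSubtype_apply_of_mem p.1 hi, notMem_activeRows.1 hi j]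
    exact notMem_activeRows.1 (p.1 ⟨i, hi⟩).2 j
  · rw [Perm.ofSubtype_apply_of_not_mem p.1 hi]

/-- The embedding of the permutations of the constant rows and columns into the stabilizer. -/
noncomputable def constPerm (q : ℕ) (N : Fin k → Fin k → ℕ)
    (p : Perm {i // i ∉ activeRows q N} × Perm {j // j ∉ activeRows q fun i j => N j i}) :
    {p : Perm (Fin k) × Perm (Fin k) // ∀ i j, N (p.1 i) (p.2 j) = N i j} :=
  ⟨(Perm.ofSubtype p.1, Perm.ofSubtype p.2), ofSubtype_stabilizes p⟩

lemma constPerm_injective : Function.Injective (constPerm q N) := fun p p' h => by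
  have h1 := congrArg Subtype.val h
  exact Prod.ext (Perm.ofSubtype_injective (congrArg Prod.fst h1))
    (Perm.ofSubtype_injective (congrArg Prod.snd h1))

lemma card_constPerm_domain : Nat.card
    (Perm {i // i ∉ activeRows q N} × Perm {j // j ∉ activeRows q fun i j => N j i}) =
    (k - #(activeRows q N)).factorial * (k - #(activeRows q fun i j => N j i)).factorial := by
  rw [Nat.card_prod, Nat.card_perm, Nat.card_perm]
  simp [Fintype.card_subtype_compl]

lemma factorial_mul_factorial_le_stabCard :
    (k - #(activeRows q N)).factorial * (k - #(activeRows q fun i j => N j i)).factorial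
      ≤ stabCard N := by
  rw [← card_constPerm_domain]
  exact Nat.card_le_card_of_injective _ constPerm_injective

lemma factorial_mul_factorial_lt_stabCard
    (p : {p : Perm (Fin k) × Perm (Fin k) // ∀ i j, N (p.1 i) (p.2 j) = N i j})
    {i : Fin k} (hi : i ∈ activeRows q N) (hp : p.1.1 i ≠ i) :
    (k - #(activeRows q N)).factorial * (k - #(activeRows q fun i j => N j i)).factorial
      < stabCard N := by
  rw [← card_constPerm_domain, stabCard, Nat.card_eq_fintype_card, Nat.card_eq_fintype_card]
  refine Fintype.card_lt_of_injective_of_notMem (constPerm q N) constPerm_injective (b := p) ?_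
  rintro ⟨c, rfl⟩
  exact hp (Perm.ofSubtype_apply_of_not_mem c.1 (not_not.2 hi))

lemma stabCard_pos_s5 : 1 ≤ stabCard N := by
  have : Nonempty {p : Perm (Fin k) × Perm (Fin k) // ∀ i j, N (p.1 i) (p.2 j) = N i j} :=
    ⟨⟨1, fun _ _ => rfl⟩⟩
  exact Nat.card_pos

end Stabilizer

section LowerBound

variable {k q : ℕ} {N : Fin k → Fin k → ℕ}

/-- If every nonconstant row and column has excess one, then `N` is the constant matrix `q` plus a
permutation matrix minus a permutation matrix. -/
lemma exists_perm_decomposition (h : IsInterMatrix k (q * k) N)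
    (hR : #(activeRows q N) = excess q N)
    (hC : #(activeRows q fun i j => N j i) = excess q N) :
    ∃ σ τ : Perm (Fin k), ∀ i j,
      N i j + (if j = τ i then 1 else 0) = q + (if j = σ i then 1 else 0) := by
  have hrow : ∀ i : {i // i ∈ activeRows q N}, ∃ a b, ∀ j,
      N i j + (if j = b then 1 else 0) = q + (if j = a then 1 else 0) := fun i =>
    exists_form_of_sum_excess_eq_one (h.1 i) (sum_excess_eq_one h hR i.2)
  have hcol : ∀ j : {j // j ∈ activeRows q fun i j => N j i}, ∃ c d, ∀ i,
      N i j + (if i = d then 1 else 0) = q + (if i = c then 1 else 0) := fun j =>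
    exists_form_of_sum_excess_eq_one (h.2 j)
      (sum_excess_eq_one h.transpose (hC.trans excess_transpose.symm) j.2)
  choose a b hab using hrow
  choose c d hcd using hcol
  have hne : ∀ i, a i ≠ b i := fun i hi => by
    obtain ⟨j, hj⟩ := mem_activeRows.1 i.2
    have := hab i j
    rw [hi] at this
    omega
  have ha : ∀ i : {i // i ∈ activeRows q N}, N i (a i) = q + 1 := fun i => by
    have := hab i (a i)
    rwa [if_neg (hne i), if_pos rfl] at this
  have hb : ∀ i : {i // i ∈ activeRows q N}, N i (b i) + 1 = q := fun i => by
    have := hab i (b i)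
    rwa [if_neg (hne i).symm, if_pos rfl] at this
  let σ₀ : {i // i ∈ activeRows q N} → {j // j ∈ activeRows q fun i j => N j i} := fun i =>
    ⟨a i, mem_activeRows.2 ⟨i, by have := ha i; omega⟩⟩
  let τ₀ : {i // i ∈ activeRows q N} → {j // j ∈ activeRows q fun i j => N j i} := fun i =>
    ⟨b i, mem_activeRows.2 ⟨i, by have := hb i; omega⟩⟩
  have hcard : Fintype.card {i // i ∈ activeRows q N} =
      Fintype.card {j // j ∈ activeRows q fun i j => N j i} := by
    simp [hR, hC]
  have hcσ : ∀ i : {i // i ∈ activeRows q N}, (i : Fin k) = c (σ₀ i) := fun i => by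
    by_contra hi
    have h1 := hcd (σ₀ i) i
    have h2 : N i (σ₀ i) = q + 1 := ha i
    rw [if_neg hi] at h1
    omega
  have hdτ : ∀ i : {i // i ∈ activeRows q N}, (i : Fin k) = d (τ₀ i) := fun i => by
    by_contra hi
    have h1 := hcd (τ₀ i) i
    have h2 : N i (τ₀ i) + 1 = q := hb i
    rw [if_neg hi] at h1
    omega
  have hσ : Function.Bijective σ₀ := (Fintype.bijective_iff_injective_and_card _).2
    ⟨fun i i' hi => Subtype.ext (by rw [hcσ i, hcσ i', hi]), hcard⟩
  have hτ : Function.Bijective τ₀ := (Fintype.bijective_iff_injective_and_card _).2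
    ⟨fun i i' hi => Subtype.ext (by rw [hdτ i, hdτ i', hi]), hcard⟩
  obtain ⟨e⟩ : Nonempty ({i // i ∉ activeRows q N} ≃
      {j // j ∉ activeRows q fun i j => N j i}) := by
    rw [← Fintype.card_eq]
    simp [Fintype.card_subtype_compl, hR, hC]
  refine ⟨Equiv.subtypeCongr (Equiv.ofBijective σ₀ hσ) e,
    Equiv.subtypeCongr (Equiv.ofBijective τ₀ hτ) e, fun i j => ?_⟩
  by_cases hi : i ∈ activeRows q N
  · simpa [Equiv.subtypeCongr, Equiv.sumCompl_symm_apply_of_pos, hi, σ₀, τ₀] using hab ⟨i, hi⟩ j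
  · simp [Equiv.subtypeCongr, Equiv.sumCompl_symm_apply_of_neg, hi, notMem_activeRows.1 hi j]

lemma factorial_mul_factorial_lt_stabCard_of_tight (h : IsInterMatrix k (q * k) N)
    (hR : #(activeRows q N) = excess q N)
    (hC : #(activeRows q fun i j => N j i) = excess q N) (hs : 0 < excess q N) :
    (k - #(activeRows q N)).factorial * (k - #(activeRows q fun i j => N j i)).factorial
      < stabCard N := by
  obtain ⟨σ, τ, hστ⟩ := exists_perm_decomposition h hR hC
  obtain ⟨i, hi⟩ := card_pos.1 (hR ▸ hs)
  refine factorial_mul_factorial_lt_stabCard ⟨(τ⁻¹ * σ, σ * τ⁻¹), fun i j => ?_⟩ hi fun hfix => ?_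
  · have h1 := hστ ((τ⁻¹ * σ) i) ((σ * τ⁻¹) j)
    have h2 := hστ i j
    have e1 : (σ * τ⁻¹) j = τ ((τ⁻¹ * σ) i) ↔ j = τ i := by
      simp [Equiv.symm_apply_eq]
    have e2 : (σ * τ⁻¹) j = σ ((τ⁻¹ * σ) i) ↔ j = σ i := by
      simp
    simp only [e1, e2] at h1
    exact Nat.add_right_cancel (h1.trans h2.symm)
  · obtain ⟨j, hj⟩ := mem_activeRows.1 hi
    have e1 : σ i = τ i := by simpa [Equiv.symm_apply_eq] using hfix
    have h1 := hστ i j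
    rw [e1] at h1
    omega

lemma two_pow_lt_stabCard (h : IsInterMatrix k (q * k) N) (hk : 3 ≤ k) {t : ℕ} (ht : 1 ≤ t)
    (hs : excess q N + t = k) : 2 ^ t < stabCard N ∨ t = 1 ∧ 2 ≤ stabCard N := by
  have hR := card_activeRows_le_excess h
  have hC := card_activeRows_le_excess h.transpose
  rw [excess_transpose] at hC
  have hg := factorial_mul_factorial_le_stabCard (q := q) (N := N)
  have hlt := factorial_mul_factorial_lt_stabCard_of_tight h
  generalize hz : k - #(activeRows q N) = z at hg hlt
  generalize hz' : k - #(activeRows q fun i j => N j i) = z' at hg hlt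
  have hzt : t ≤ z := by omega
  have hzt' : t ≤ z' := by omega
  have hle := Nat.mul_le_mul (Nat.factorial_le hzt) (Nat.factorial_le hzt')
  rcases le_or_gt 3 t with h3 | h3
  · exact .inl ((two_pow_lt_factorial_mul_factorial h3).trans_le (hle.trans hg))
  have hstrict : t.factorial * (t + 1).factorial ≤ stabCard N ∨
      t.factorial * t.factorial < stabCard N := by
    rcases hzt.eq_or_lt with h1 | h1
    · rcases hzt'.eq_or_lt with h2 | h2
      · exact .inr (hle.trans_lt (hlt (by omega) (by omega) (by omega)))
      · exact .inl ((Nat.mul_le_mul (Nat.factorial_le hzt) (Nat.factorial_le h2)).trans hg)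
    · rw [mul_comm]
      exact .inl ((Nat.mul_le_mul (Nat.factorial_le h1) (Nat.factorial_le hzt')).trans hg)
  obtain rfl | rfl : t = 1 ∨ t = 2 := by omega
  all_goals simp [Nat.factorial] at hstrict ⊢; omega

lemma sum_deficit_eq_excess (h : IsInterMatrix k (q * k) N) :
    ∑ i, ∑ j, (q - N i j) = excess q N :=
  sum_congr rfl fun i _ => (sum_excess_eq_sum_deficit (h.1 i)).symm

lemma prod_factorial_mul_pow (h : IsInterMatrix k (q * k) N) :
    (∏ i, ∏ j, (N i j).factorial) * q ^ excess q N =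
      ∏ p : Fin k × Fin k, (N p.1 p.2).factorial * q ^ (q - N p.1 p.2) := by
  rw [prod_mul_distrib, prod_pow_eq_pow_sum, Fintype.prod_prod_type, Fintype.sum_prod_type,
    sum_deficit_eq_excess h]

lemma factorial_pow_mul_pow :
    q.factorial ^ (k ^ 2) * (q + 1) ^ excess q N =
      ∏ p : Fin k × Fin k, q.factorial * (q + 1) ^ (N p.1 p.2 - q) := by
  rw [prod_mul_distrib, prod_pow_eq_pow_sum, Fintype.sum_prod_type, excess]
  simp [sq]

lemma le_prod_factorial (h : IsInterMatrix k (q * k) N) :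
    q.factorial ^ (k ^ 2) * (q + 1) ^ excess q N ≤
      (∏ i, ∏ j, (N i j).factorial) * q ^ excess q N := by
  rw [prod_factorial_mul_pow h, factorial_pow_mul_pow]
  exact prod_le_prod' fun p _ => factorial_entry_le _

lemma entry_eq_of_prod_factorial_le (hq : 1 ≤ q) (h : IsInterMatrix k (q * k) N)
    (hle : (∏ i, ∏ j, (N i j).factorial) * q ^ excess q N ≤
      q.factorial ^ (k ^ 2) * (q + 1) ^ excess q N) (i j : Fin k) :
    N i j = q + 1 ∨ N i j = q ∨ N i j = q - 1 := by
  rw [prod_factorial_mul_pow h, factorial_pow_mul_pow] at hle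
  refine factorial_entry_eq hq (not_lt.1 fun hlt => hle.not_gt ?_)
  exact prod_lt_prod (fun p _ => by positivity) (fun p _ => factorial_entry_le _)
    ⟨(i, j), mem_univ _, hlt⟩

lemma multiset_eq_of_mem (hq : 1 ≤ q) (M : Multiset ℕ)
    (hM : ∀ x ∈ M, x = q + 1 ∨ x = q ∨ x = q - 1) :
    ∃ c, M = Multiset.replicate (M.map (· - q)).sum (q + 1) + Multiset.replicate c q +
      Multiset.replicate (M.map (q - ·)).sum (q - 1) := by
  induction M using Multiset.induction with
  | empty => exact ⟨0, by simp⟩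
  | cons x M ih =>
    obtain ⟨c, hc⟩ := ih fun y hy => hM y (Multiset.mem_cons_of_mem hy)
    rw [Multiset.map_cons, Multiset.map_cons, Multiset.sum_cons, Multiset.sum_cons]
    rcases hM x (Multiset.mem_cons_self x M) with rfl | rfl | rfl
    · refine ⟨c, ?_⟩
      rw [show q + 1 - q = 1 by omega, show q - (q + 1) = 0 by omega, zero_add, add_comm 1,
        Multiset.replicate_succ, Multiset.cons_add, Multiset.cons_add, ← hc]
    · refine ⟨c + 1, ?_⟩
      rw [Nat.sub_self, zero_add, zero_add, Multiset.replicate_succ, Multiset.add_cons,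
        Multiset.cons_add, ← hc]
    · refine ⟨c, ?_⟩
      rw [show q - 1 - q = 0 by omega, show q - (q - 1) = 1 by omega, zero_add, add_comm 1,
        Multiset.replicate_succ, Multiset.add_cons, ← hc]

lemma entries_eq (hq : 1 ≤ q) (h : IsInterMatrix k (q * k) N)
    (hN : ∀ i j, N i j = q + 1 ∨ N i j = q ∨ N i j = q - 1) :
    entries N = Multiset.replicate (excess q N) (q + 1) +
      Multiset.replicate (k ^ 2 - 2 * excess q N) q +
      Multiset.replicate (excess q N) (q - 1) := by
  have hmem : ∀ x ∈ entries N, x = q + 1 ∨ x = q ∨ x = q - 1 := fun x hx => by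
    obtain ⟨p, -, rfl⟩ := Multiset.mem_map.1 hx
    exact hN _ _
  have h1 : ((entries N).map (· - q)).sum = excess q N := by
    rw [entries, Multiset.map_map, excess, ← Fintype.sum_prod_type']
    rfl
  have h2 : ((entries N).map (q - ·)).sum = excess q N := by
    rw [entries, Multiset.map_map, ← sum_deficit_eq_excess h, ← Fintype.sum_prod_type']
    rfl
  have h3 : (entries N).card = k ^ 2 := by simp [entries, sq]
  obtain ⟨c, hc⟩ := multiset_eq_of_mem hq _ hmem
  rw [h1, h2] at hc
  rw [hc, Multiset.card_add, Multiset.card_add, Multiset.card_replicate, Multiset.card_replicate,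
    Multiset.card_replicate] at h3
  rw [hc, show c = k ^ 2 - 2 * excess q N by omega]

/-- The claimed minimum, cleared of the denominator `q ^ k`. -/
lemma chi_mul_pow (hk : 2 ≤ k) (hq : 1 ≤ q) :
    (q + 1).factorial ^ k * q.factorial ^ (k ^ 2 - 2 * k) * (q - 1).factorial ^ k * q ^ k =
      q.factorial ^ (k ^ 2) * (q + 1) ^ k := by
  obtain ⟨q, rfl⟩ := Nat.exists_eq_add_of_le' hq
  obtain ⟨c, hc⟩ := Nat.exists_eq_add_of_le (show 2 * k ≤ k ^ 2 by nlinarith)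
  rw [hc, Nat.add_sub_cancel_left, Nat.add_sub_cancel, Nat.factorial_succ (q + 1),
    Nat.factorial_succ q]
  simp only [mul_pow, pow_add, pow_mul]
  generalize q + 1 = a
  ring

/-- A matrix whose automorphism count is at most the claimed minimum attains it and has one of the
two claimed shapes. -/
lemma shape_of_autCard_le (hk : 3 ≤ k) (hq : 1 ≤ q) (h : IsInterMatrix k (q * k) N)
    (hle : autCard N ≤
      (q + 1).factorial ^ k * q.factorial ^ (k ^ 2 - 2 * k) * (q - 1).factorial ^ k) :
    (q + 1).factorial ^ k * q.factorial ^ (k ^ 2 - 2 * k) * (q - 1).factorial ^ k ≤ autCard N ∧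
    ((stabCard N = 1 ∧
        entries N = Multiset.replicate k (q + 1) + Multiset.replicate (k ^ 2 - 2 * k) q +
          Multiset.replicate k (q - 1)) ∨
      (q = 1 ∧ stabCard N = 2 ∧
        entries N = Multiset.replicate (k - 1) 2 + Multiset.replicate (k ^ 2 - 2 * k + 2) 1 +
          Multiset.replicate (k - 1) 0)) := by
  have hT := chi_mul_pow (by omega : 2 ≤ k) hq
  have hA := le_prod_factorial h
  have hA' := entry_eq_of_prod_factorial_le hq h
  have hE := entries_eq hq h
  have hg := stabCard_pos_s5 (N := N)
  have hg2 := fun t => two_pow_lt_stabCard h hk (t := t)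
  have hQ : 0 < q.factorial ^ (k ^ 2) := by positivity
  rw [autCard] at hle ⊢
  generalize (q + 1).factorial ^ k * q.factorial ^ (k ^ 2 - 2 * k) * (q - 1).factorial ^ k = T
    at hle hT ⊢
  generalize ∏ i, ∏ j, (N i j).factorial = A at hle hA hA' ⊢
  generalize stabCard N = g at hle hg hg2 ⊢
  generalize excess q N = s at hA hA' hE hg2
  generalize q.factorial ^ (k ^ 2) = Q at hT hA hA' hQ
  rcases le_or_gt k s with hks | hks
  · obtain ⟨u, rfl⟩ := Nat.exists_eq_add_of_le hks
    have h1 : g * (q + 1) ^ u ≤ q ^ u := by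
      refine Nat.le_of_mul_le_mul_left (c := Q * (q + 1) ^ k) ?_ (by positivity)
      calc Q * (q + 1) ^ k * (g * (q + 1) ^ u) = g * (Q * (q + 1) ^ (k + u)) := by ring
        _ ≤ g * (A * q ^ (k + u)) := Nat.mul_le_mul_left _ hA
        _ = g * A * (q ^ k * q ^ u) := by ring
        _ ≤ T * (q ^ k * q ^ u) := Nat.mul_le_mul_right _ hle
        _ = Q * (q + 1) ^ k * q ^ u := by rw [← mul_assoc, hT]
    obtain rfl : u = 0 := by
      by_contra hu
      have h2 : q ^ u < (q + 1) ^ u := Nat.pow_lt_pow_left (by omega) hu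
      exact absurd (h1.trans_lt h2) (not_lt.2 (Nat.le_mul_of_pos_left _ hg))
    obtain rfl : g = 1 := by
      rw [pow_zero, pow_zero] at h1
      omega
    rw [add_zero] at hA hA' hE
    rw [one_mul] at hle ⊢
    have hTA : T ≤ A := Nat.le_of_mul_le_mul_right (hT.le.trans hA) (by positivity)
    exact ⟨hTA, .inl ⟨rfl, hE (hA' (hT ▸ Nat.mul_le_mul_right _ hle))⟩⟩
  · obtain ⟨t, rfl⟩ := Nat.exists_eq_add_of_le hks.le
    have h1 : g * q ^ t ≤ (q + 1) ^ t := by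
      refine Nat.le_of_mul_le_mul_left (c := Q * (q + 1) ^ s) ?_ (by positivity)
      calc Q * (q + 1) ^ s * (g * q ^ t) = g * q ^ t * (Q * (q + 1) ^ s) := by ring
        _ ≤ g * q ^ t * (A * q ^ s) := Nat.mul_le_mul_left _ hA
        _ = g * A * q ^ (s + t) := by ring
        _ ≤ T * q ^ (s + t) := Nat.mul_le_mul_right _ hle
        _ = Q * (q + 1) ^ s * (q + 1) ^ t := by rw [hT]; ring
    have h2 : g ≤ 2 ^ t := by
      refine Nat.le_of_mul_le_mul_right (c := q ^ t) ?_ (by positivity)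
      rw [← mul_pow]
      exact h1.trans (Nat.pow_le_pow_left (by omega) t)
    rcases hg2 t (by omega) rfl with h3 | ⟨rfl, h3⟩
    · omega
    obtain rfl : g = 2 := by omega
    obtain rfl : q = 1 := by
      rw [pow_one, pow_one] at h1
      omega
    rw [pow_succ (1 + 1) s, ← mul_assoc] at hT
    simp only [one_pow, mul_one] at hT hA hA'
    refine ⟨by omega, .inr ⟨rfl, rfl, ?_⟩⟩
    rw [hE (hA' (by omega)), Nat.add_sub_cancel,
      show (s + 1) ^ 2 - 2 * s = (s + 1) ^ 2 - 2 * (s + 1) + 2 by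
        have : 2 * (s + 1) ≤ (s + 1) ^ 2 := by nlinarith
        omega]

end LowerBound

section Construction

variable {k q : ℕ}

/-- The source map of the digraph on `Fin k`, with arcs indexed by `Fin k`, that consists of the
closed walks `0 → 1 → 0` and `0 → 2 → 3 → ⋯ → k - 2 → 0` and the isolated vertex `k - 1`. -/
def arcSource (j : Fin k) : Fin k :=
  ⟨if j.1 = 1 then 1 else if j.1 = 2 then 0 else j.1 - 1, by split_ifs <;> omega⟩

/-- The target map of the same digraph. -/
def arcTarget (hk : 5 ≤ k) (j : Fin k) : Fin k :=
  ⟨if j.1 = 0 then 1 else if j.1 = 1 ∨ j.1 = k - 1 then 0 else j.1, by split_ifs <;> omega⟩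

/-- The arc following a given arc on its closed walk. -/
def arcNext (hk : 5 ≤ k) (j : Fin k) : Fin k :=
  ⟨if j.1 = 0 then 1 else if j.1 = 1 then 0 else if j.1 = k - 1 then 2 else j.1 + 1,
    by split_ifs <;> omega⟩

lemma arcSource_arcNext (hk : 5 ≤ k) (j : Fin k) :
    arcSource (arcNext hk j) = arcTarget hk j := by
  ext
  simp only [arcSource, arcNext, arcTarget]
  split_ifs <;> omega

lemma arcNext_bijective (hk : 5 ≤ k) : Function.Bijective (arcNext hk) := by
  refine Finite.injective_iff_bijective.1 fun i j h => ?_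
  have := congrArg Fin.val h
  ext
  simp only [arcNext] at this
  split_ifs at this <;> omega

lemma arcSource_ne_arcTarget (hk : 5 ≤ k) (j : Fin k) : arcSource j ≠ arcTarget hk j := by
  intro h
  have := congrArg Fin.val h
  simp only [arcSource, arcTarget] at this
  split_ifs at this <;> omega

/-- The constant matrix `q` plus the signed incidence matrix of the digraph. -/
def arcMatrix (hk : 5 ≤ k) (q : ℕ) (i j : Fin k) : ℕ :=
  if i = arcSource j then q + 1 else if i = arcTarget hk j then q - 1 else q

lemma arcMatrix_add (hk : 5 ≤ k) (hq : 1 ≤ q) (i j : Fin k) :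
    arcMatrix hk q i j + (if i = arcTarget hk j then 1 else 0) =
      q + (if i = arcSource j then 1 else 0) := by
  have := arcSource_ne_arcTarget hk j
  rw [arcMatrix]
  split_ifs with h1 h2
  · exact absurd (h1.symm.trans h2) this
  all_goals omega

lemma arcMatrix_isInterMatrix (hk : 5 ≤ k) (hq : 1 ≤ q) :
    IsInterMatrix k (q * k) (arcMatrix hk q) := by
  constructor
  · intro i
    have h1 : ∑ j, (if i = arcTarget hk j then 1 else 0) =
        ∑ j, (if i = arcSource j then 1 else 0) := by
      simp only [← arcSource_arcNext]
      exact (arcNext_bijective hk).sum_comp fun j => if i = arcSource j then 1 else 0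
    have h2 := sum_congr rfl fun j (_ : j ∈ univ) => arcMatrix_add hk hq i j
    rw [sum_add_distrib, sum_add_distrib, h1] at h2
    rw [Nat.add_right_cancel h2]
    simp [mul_comm]
  · intro j
    have h2 := sum_congr rfl fun i (_ : i ∈ univ) => arcMatrix_add hk hq i j
    rw [sum_add_distrib, sum_add_distrib, sum_ite_eq', sum_ite_eq', if_pos (mem_univ _),
      if_pos (mem_univ _)] at h2
    rw [Nat.add_right_cancel h2]
    simp [mul_comm]

lemma prod_factorial_arcMatrix (hk : 5 ≤ k) :
    ∏ i, ∏ j, (arcMatrix hk q i j).factorial =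
      (q + 1).factorial ^ k * q.factorial ^ (k ^ 2 - 2 * k) * (q - 1).factorial ^ k := by
  have hcol : ∀ j, ∏ i, (arcMatrix hk q i j).factorial =
      (q + 1).factorial * q.factorial ^ (k - 2) * (q - 1).factorial := fun j => by
    have hne := arcSource_ne_arcTarget hk j
    rw [← mul_prod_erase univ _ (mem_univ (arcSource j)),
      ← mul_prod_erase _ _ (mem_erase.2 ⟨hne.symm, mem_univ (arcTarget hk j)⟩),
      prod_congr rfl (g := fun _ => q.factorial)]
    · rw [prod_const, card_erase_of_mem (mem_erase.2 ⟨hne.symm, mem_univ _⟩),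
        card_erase_of_mem (mem_univ _), card_univ, Fintype.card_fin, arcMatrix, if_pos rfl,
        arcMatrix, if_neg hne.symm, if_pos rfl, Nat.sub_sub]
      ring
    · intro i hi
      rw [mem_erase, mem_erase] at hi
      rw [arcMatrix, if_neg hi.2.1, if_neg hi.1]
  rw [prod_comm, prod_congr rfl fun j _ => hcol j, prod_const, card_univ, Fintype.card_fin,
    mul_pow, mul_pow, ← pow_mul, Nat.sub_mul, sq]

lemma stabilizer_arcMatrix_eq_one (hk : 5 ≤ k) (hq : 1 ≤ q) {ρ κ : Perm (Fin k)}
    (h : ∀ i j, arcMatrix hk q (ρ i) (κ j) = arcMatrix hk q i j) : ρ = 1 ∧ κ = 1 := by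
  have hsrc : ∀ j, ρ (arcSource j) = arcSource (κ j) := fun j => by
    have h1 := h (arcSource j) j
    rw [arcMatrix, arcMatrix, if_pos rfl] at h1
    split_ifs at h1 with h2 h3
    · exact h2
    all_goals omega
  have htgt : ∀ j, ρ (arcTarget hk j) = arcTarget hk (κ j) := fun j => by
    have h1 := h (arcTarget hk j) j
    rw [arcMatrix, arcMatrix, if_neg (arcSource_ne_arcTarget hk j).symm, if_pos rfl] at h1
    split_ifs at h1 with h2 h3
    · omega
    · exact h3
    · omega
  have src_val : ∀ j : Fin k, (arcSource j).1 =
      if j.1 = 1 then 1 else if j.1 = 2 then 0 else j.1 - 1 := fun _ => rfl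
  have tgt_val : ∀ j : Fin k, (arcTarget hk j).1 =
      if j.1 = 0 then 1 else if j.1 = 1 ∨ j.1 = k - 1 then 0 else j.1 := fun _ => rfl
  let v : ∀ n, n < k → Fin k := fun n hn => ⟨n, hn⟩
  have s0 : arcSource (v 0 (by omega)) = v 0 (by omega) := rfl
  have s1 : arcSource (v 1 (by omega)) = v 1 (by omega) := rfl
  have s2 : arcSource (v 2 (by omega)) = v 0 (by omega) := rfl
  have t0 : arcTarget hk (v 0 (by omega)) = v 1 (by omega) := rfl
  have t1 : arcTarget hk (v 1 (by omega)) = v 0 (by omega) := rfl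
  have h0 := hsrc (v 0 (by omega))
  have h1 := hsrc (v 1 (by omega))
  have h2 := hsrc (v 2 (by omega))
  have h0' := htgt (v 0 (by omega))
  have h1' := htgt (v 1 (by omega))
  rw [s0] at h0
  rw [s1] at h1
  rw [s2, h0] at h2
  rw [t0, h1] at h0'
  rw [t1, h0] at h1'
  have hne : κ (v 0 (by omega)) ≠ κ (v 2 (by omega)) := fun he => by
    simpa [v] using κ.injective he
  rw [Fin.ext_iff, src_val, src_val] at h2
  rw [Fin.ext_iff, src_val, tgt_val] at h0' h1'
  rw [Ne, Fin.ext_iff] at hne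
  have hfix02 : (κ (v 0 (by omega))).1 = 0 ∧ (κ (v 2 (by omega))).1 = 2 := by
    have hcases : (κ (v 0 (by omega))).1 = 0 ∧ (κ (v 2 (by omega))).1 = 2 ∨
        (κ (v 0 (by omega))).1 = 2 ∧ (κ (v 2 (by omega))).1 = 0 := by
      split_ifs at h2 <;> omega
    refine hcases.resolve_right fun ⟨ha, hb⟩ => ?_
    rw [ha] at h0' h1'
    split_ifs at h0' h1' <;> omega
  have hκ : ∀ n (hn : n < k), (κ (v n hn)).1 = n := by
    intro n
    induction n with
    | zero => exact fun _ => hfix02.1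
    | succ n ih =>
      intro hn
      obtain rfl | rfl | hn2 : n = 0 ∨ n = 1 ∨ 2 ≤ n := by omega
      · rw [hfix02.1] at h0'
        split_ifs at h0' <;> omega
      · exact hfix02.2
      · have e1 : arcSource (v (n + 1) hn) = v n (by omega) := by
          rw [Fin.ext_iff, src_val]
          simp only [v]
          split_ifs <;> omega
        have e2 : arcTarget hk (v n (by omega)) = v n (by omega) := by
          rw [Fin.ext_iff, tgt_val]
          simp only [v]
          split_ifs <;> omega
        have e3 := hsrc (v (n + 1) hn)
        have e4 := htgt (v n (by omega))
        rw [e1] at e3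
        rw [e2, e3, Fin.ext_iff, src_val, tgt_val, ih] at e4
        split_ifs at e4 <;> omega
  have hκ1 : κ = 1 := Equiv.ext fun j => Fin.ext (hκ j.1 j.2)
  subst hκ1
  refine ⟨?_, rfl⟩
  have hρ : ∀ i : Fin k, i.1 ≠ k - 1 → ρ i = i := fun i hi => by
    obtain ⟨j, rfl⟩ : ∃ j, arcSource j = i := by
      refine ⟨⟨if i.1 = 0 then 0 else if i.1 = 1 then 1 else i.1 + 1, ?_⟩, ?_⟩
      · split_ifs <;> omega
      · rw [Fin.ext_iff, src_val]
        dsimp only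
        split_ifs <;> first | contradiction | omega
    exact hsrc j
  refine Equiv.ext fun i => ?_
  by_cases hi : i.1 = k - 1
  · by_cases hi' : (ρ i).1 = k - 1
    · exact Fin.ext (hi'.trans hi.symm)
    · exact ρ.injective (hρ _ hi')
  · exact hρ i hi

lemma stabCard_arcMatrix (hk : 5 ≤ k) (hq : 1 ≤ q) : stabCard (arcMatrix hk q) = 1 := by
  refine Nat.card_eq_one_iff_unique.2 ⟨⟨fun p p' => ?_⟩, ⟨⟨1, fun _ _ => rfl⟩⟩⟩
  obtain ⟨h1, h2⟩ := stabilizer_arcMatrix_eq_one hk hq p.2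
  obtain ⟨h1', h2'⟩ := stabilizer_arcMatrix_eq_one hk hq p'.2
  exact Subtype.ext (Prod.ext (h1.trans h1'.symm) (h2.trans h2'.symm))

end Construction

end Auxiliary

/-- χ(k,qk) = (q+1)!^k q!^{k²−2k} (q−1)!^k for k ≥ 7, q ≥ 1, qk > 2, together with the
structure of the minimising matrices. -/
theorem chi_zero (k q : ℕ) (hk : 7 ≤ k) (hq : 1 ≤ q) (hl : 2 < q * k) :
    IsLeast {m | ∃ N : Fin k → Fin k → ℕ, IsInterMatrix k (q * k) N ∧ m = autCard N}
      ((q + 1).factorial ^ k * q.factorial ^ (k ^ 2 - 2 * k) * (q - 1).factorial ^ k) ∧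
    ∀ N : Fin k → Fin k → ℕ, IsInterMatrix k (q * k) N →
      autCard N = (q + 1).factorial ^ k * q.factorial ^ (k ^ 2 - 2 * k) * (q - 1).factorial ^ k →
      (stabCard N = 1 ∧
        entries N = Multiset.replicate k (q + 1) + Multiset.replicate (k ^ 2 - 2 * k) q +
          Multiset.replicate k (q - 1)) ∨
      (q = 1 ∧ stabCard N = 2 ∧
        entries N = Multiset.replicate (k - 1) 2 + Multiset.replicate (k ^ 2 - 2 * k + 2) 1 +
          Multiset.replicate (k - 1) 0) := by
  refine ⟨⟨⟨arcMatrix (by omega) q, arcMatrix_isInterMatrix _ hq, ?_⟩, ?_⟩, fun N hN h => ?_⟩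
  · rw [autCard, stabCard_arcMatrix _ hq, one_mul, prod_factorial_arcMatrix]
  · rintro _ ⟨N, hN, rfl⟩
    rcases le_total (autCard N) ((q + 1).factorial ^ k * q.factorial ^ (k ^ 2 - 2 * k) *
      (q - 1).factorial ^ k) with h | h
    · exact (shape_of_autCard_le (by omega) hq hN h).1
    · exact h
  · exact (shape_of_autCard_le (by omega) hq hN h.le).2
end
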